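/- Corollary. Given an implicitization-matrix datum for φ (so det M = c·F^δ with c ∈ K nonzero and δ ≥ 1), if φ is not proper, then δ ≥ 2; in particular F² divides det M. -/

import Mathlib

open MvPolynomial

/-- The rational function field `K(u,v)`, realized as the fraction field of `K[u,v]`. -/
noncomputable abbrev RatFuncTwo (K : Type*) [Field K] : Type _ :=
  FractionRing (MvPolynomial (Fin 2) K)

/-- The three affine coordinates `φᵢ = pᵢ(u,v,1)/p₄(u,v,1)` (for `i = 1,2,3`) of the
parameterization `φ` determined by `p = (p₁,p₂,p₃,p₄)`, as elements of `K(u,v)`. -/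
noncomputable def phiCoord {K : Type*} [Field K]
    (p : Fin 4 → MvPolynomial (Fin 3) K) (i : Fin 3) : RatFuncTwo K :=
  algebraMap (MvPolynomial (Fin 2) K) (RatFuncTwo K)
      (MvPolynomial.aeval ![MvPolynomial.X 0, MvPolynomial.X 1, 1] (p i.castSucc)) /
    algebraMap (MvPolynomial (Fin 2) K) (RatFuncTwo K)
      (MvPolynomial.aeval ![MvPolynomial.X 0, MvPolynomial.X 1, 1] (p 3))

/-- `φ` is proper (birational onto its image) if the subfield `K(φ₁,φ₂,φ₃)` of `K(u,v)`
generated over `K` by `φ₁, φ₂, φ₃` is all of `K(u,v)`. -/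
noncomputable def IsProperParam {K : Type*} [Field K]
    (p : Fin 4 → MvPolynomial (Fin 3) K) : Prop :=
  IntermediateField.adjoin K {phiCoord p 0, phiCoord p 1, phiCoord p 2} = ⊤

/-- Scaling the arguments of a homogeneous polynomial of degree `N` by `r` scales its value by
`r ^ N`. -/
theorem aeval_mul_of_isHomogeneous {σ R A : Type*} [CommSemiring R] [CommSemiring A] [Algebra R A]
    {q : MvPolynomial σ R} {N : ℕ} (hq : q.IsHomogeneous N) (r : A) (x : σ → A) :
    aeval (fun i => r * x i) q = r ^ N * aeval x q := by
  simp only [aeval_def, eval₂_eq, Finset.mul_sum]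
  refine Finset.sum_congr rfl fun d hd => ?_
  have hdeg : ∑ i ∈ d.support, d i = N := (hq.degree_eq_sum_deg_support hd).symm
  simp only [mul_pow, Finset.prod_mul_distrib, Finset.prod_pow_eq_pow_sum, hdeg]
  ring

/-- The determinant of a matrix whose `j`-th column is homogeneous of degree `e j` is homogeneous
of degree `∑ j, e j`. -/
theorem det_isHomogeneous_of_columns {σ R ι : Type*} [CommRing R] [Fintype ι] [DecidableEq ι]
    {A : Matrix ι ι (MvPolynomial σ R)} {e : ι → ℕ} (hA : ∀ i j, (A i j).IsHomogeneous (e j)) :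
    A.det.IsHomogeneous (∑ j, e j) := by
  rw [Matrix.det_apply]
  refine IsHomogeneous.sum _ _ _ fun τ _ => ?_
  have h : (∏ i, A (τ i) i).IsHomogeneous (∑ j, e j) :=
    IsHomogeneous.prod _ _ _ fun i _ => hA (τ i) i
  rcases Int.units_eq_one_or (Equiv.Perm.sign τ) with hs | hs <;> rw [hs]
  · simpa using h
  · simpa using h.neg

/-- Cofactor expansion along the column `j`, with the cofactors written as determinants in which
this column is replaced by a standard basis vector. -/
theorem det_eq_sum_mul_det_updateCol_single {ι R : Type*} [CommRing R] [Fintype ι] [DecidableEq ι]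
    (A : Matrix ι ι R) (j : ι) :
    A.det = ∑ i, A i j * (A.updateCol j (Pi.single i 1)).det := by
  have h := congrFun (Matrix.cramer_eq_adjugate_mulVec A fun i => A i j) j
  rw [Matrix.cramer_apply] at h
  have h2 : A.updateCol j (fun i => A i j) = A := Matrix.updateCol_eq_self A j
  rw [h2] at h
  rw [h, Matrix.mulVec, dotProduct]
  refine Finset.sum_congr rfl fun i _ => ?_
  rw [← Matrix.cramer_apply, Matrix.cramer_eq_adjugate_mulVec, Matrix.mulVec_single_one,
    Matrix.col_apply, mul_comm]

/-- A row vector annihilating every column of `A` except possibly the `j`-th one is proportional to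
the vector of cofactors of the `j`-th column. -/
theorem mul_det_updateCol_single_eq {ι R : Type*} [CommRing R] [Fintype ι] [DecidableEq ι]
    (A : Matrix ι ι R) (j : ι) (v : ι → R) (hv : ∀ k, k ≠ j → ∑ i, v i * A i k = 0) (i k : ι) :
    v i * (A.updateCol j (Pi.single k 1)).det = v k * (A.updateCol j (Pi.single i 1)).det := by
  set B := A.updateCol j (Pi.single k 1) with hB
  have hvB : Matrix.vecMul v B = Pi.single j (v k) := by
    funext l
    rw [Matrix.vecMul, dotProduct]
    by_cases hl : l = j
    · subst hl
      simp [hB, Pi.single_apply]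
    · simp [hB, Matrix.updateCol_ne hl, hv l hl, Pi.single_eq_of_ne hl]
  have h : Matrix.vecMul (Matrix.vecMul v B) B.adjugate = Matrix.vecMul v (B.det • 1) := by
    rw [Matrix.vecMul_vecMul, Matrix.mul_adjugate]
  have hi := congrFun h i
  rw [hvB, Matrix.vecMul_smul, Matrix.vecMul_one, Matrix.single_vecMul] at hi
  have hadj : B.adjugate j i = (A.updateCol j (Pi.single i 1)).det := by
    have := congrFun (Matrix.cramer_eq_adjugate_mulVec B (Pi.single i 1)) j
    rw [Matrix.cramer_apply, Matrix.mulVec_single_one, Matrix.col_apply, hB,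
      Matrix.updateCol_idem] at this
    exact this.symm
  rw [Pi.smul_apply, Pi.smul_apply, smul_eq_mul, smul_eq_mul, Matrix.row_apply, hadj] at hi
  rw [hi, mul_comm]

/-- The dehomogenization of a nonzero homogeneous polynomial with respect to the last variable
is nonzero. -/
theorem dehomogenize_ne_zero {K : Type*} [Field K] {q : MvPolynomial (Fin 3) K} {N : ℕ}
    (hq : q.IsHomogeneous N) (h0 : q ≠ 0) :
    aeval ![(X 0 : MvPolynomial (Fin 2) K), X 1, 1] q ≠ 0 := by
  intro h
  let L := FractionRing (MvPolynomial (Fin 3) K)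
  let t : Fin 3 → L := fun i => algebraMap (MvPolynomial (Fin 3) K) L (X i)
  have ht : t 2 ≠ 0 := by
    simp [t, X_ne_zero]
  have hL : aeval ![t 0 / t 2, t 1 / t 2, 1] q = 0 := by
    have := congrArg (aeval (R := K) ![t 0 / t 2, t 1 / t 2]) h
    rw [map_zero, ← AlgHom.comp_apply, comp_aeval] at this
    rw [← this]
    congr 2
    funext i
    fin_cases i <;> simp
  have hs := aeval_mul_of_isHomogeneous hq (t 2) ![t 0 / t 2, t 1 / t 2, 1]
  rw [hL, mul_zero] at hs
  have ht' : (fun i => t 2 * ![t 0 / t 2, t 1 / t 2, 1] i) = t := by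
    funext i
    fin_cases i <;> simp [mul_div_cancel₀, ht]
  rw [ht'] at hs
  have : aeval t q = algebraMap (MvPolynomial (Fin 3) K) L q := by
    rw [show t = algebraMap (MvPolynomial (Fin 3) K) L ∘ X from rfl,
      aeval_algebraMap_apply, aeval_X_left_apply]
  rw [this] at hs
  exact h0 (by simpa using hs)

/-- An intermediate field of `K(u,v)` containing `u` and `v` is everything. -/
theorem eq_top_of_X_mem {K : Type*} [Field K] {S : IntermediateField K (RatFuncTwo K)}
    (hS : ∀ i, algebraMap (MvPolynomial (Fin 2) K) (RatFuncTwo K) (X i) ∈ S) : S = ⊤ := by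
  have hpoly : ∀ q, algebraMap (MvPolynomial (Fin 2) K) (RatFuncTwo K) q ∈ S := by
    intro q
    induction q using MvPolynomial.induction_on with
    | C a =>
      have : algebraMap (MvPolynomial (Fin 2) K) (RatFuncTwo K) (C a) =
          algebraMap K (RatFuncTwo K) a := by
        rw [IsScalarTower.algebraMap_apply K (MvPolynomial (Fin 2) K) (RatFuncTwo K)]
        rfl
      rw [this]
      exact S.algebraMap_mem a
    | add f g hf hg => rw [map_add]; exact S.add_mem hf hg
    | mul_X f i hf => rw [map_mul]; exact S.mul_mem hf (hS i)
  rw [eq_top_iff]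
  intro x _
  obtain ⟨f, g, -, rfl⟩ := IsFractionRing.div_surjective (A := MvPolynomial (Fin 2) K) x
  exact S.div_mem (hpoly f) (hpoly g)

/-- If `x · g(p) = f(p)` in `K(u,v)` for homogeneous `f` and `g` of the same degree, where `p` is
read in the affine chart and `g(p) ≠ 0`, then `x` lies in `K(φ₁,φ₂,φ₃)`. -/
theorem mem_adjoin_phiCoord {K : Type*} [Field K] {p : Fin 4 → MvPolynomial (Fin 3) K}
    {f g : MvPolynomial (Fin 4) K} {E : ℕ} (hf : f.IsHomogeneous E) (hg : g.IsHomogeneous E)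
    (h3 : aeval ![(X 0 : MvPolynomial (Fin 2) K), X 1, 1] (p 3) ≠ 0)
    (hg0 : aeval ![(X 0 : MvPolynomial (Fin 2) K), X 1, 1] (aeval p g) ≠ 0)
    {x : MvPolynomial (Fin 2) K}
    (hx : x * aeval ![(X 0 : MvPolynomial (Fin 2) K), X 1, 1] (aeval p g) =
      aeval ![(X 0 : MvPolynomial (Fin 2) K), X 1, 1] (aeval p f)) :
    algebraMap (MvPolynomial (Fin 2) K) (RatFuncTwo K) x ∈
      IntermediateField.adjoin K {phiCoord p 0, phiCoord p 1, phiCoord p 2} := by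
  set S := IntermediateField.adjoin K {phiCoord p 0, phiCoord p 1, phiCoord p 2}
  let ι := algebraMap (MvPolynomial (Fin 2) K) (RatFuncTwo K)
  have hι : Function.Injective ι := IsFractionRing.injective _ _
  let δ₀ := aeval (R := K) ![(X 0 : MvPolynomial (Fin 2) K), X 1, 1]
  let y : Fin 4 → RatFuncTwo K := ![phiCoord p 0, phiCoord p 1, phiCoord p 2, 1]
  have hc : ι (δ₀ (p 3)) ≠ 0 := (map_ne_zero_iff ι hι).mpr h3
  have hy : ∀ i, y i ∈ S := by
    intro i
    fin_cases i
    · exact IntermediateField.subset_adjoin _ _ (Or.inl rfl)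
    · exact IntermediateField.subset_adjoin _ _ (Or.inr (Or.inl rfl))
    · exact IntermediateField.subset_adjoin _ _ (Or.inr (Or.inr rfl))
    · exact S.one_mem
  have hyp : (fun i => ι (δ₀ (p 3)) * y i) = fun i => ι (δ₀ (p i)) := by
    funext i
    fin_cases i
    · exact mul_div_cancel₀ _ hc
    · exact mul_div_cancel₀ _ hc
    · exact mul_div_cancel₀ _ hc
    · exact mul_one _
  have hval : ∀ q : MvPolynomial (Fin 4) K, q.IsHomogeneous E →
      ι (δ₀ (aeval p q)) = ι (δ₀ (p 3)) ^ E * aeval y q := by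
    intro q hq
    rw [← aeval_mul_of_isHomogeneous hq, hyp, ← AlgHom.comp_apply, comp_aeval]
    exact (aeval_algebraMap_apply (RatFuncTwo K) (fun i => δ₀ (p i)) q).symm
  have hmem : ∀ q : MvPolynomial (Fin 4) K, aeval y q ∈ S := by
    intro q
    have : aeval y q = S.val (aeval (fun i => (⟨y i, hy i⟩ : S)) q) := by
      rw [← AlgHom.comp_apply, comp_aeval]
      rfl
    rw [this]
    exact SetLike.coe_mem _
  have hgy : ι (δ₀ (p 3)) ^ E * aeval y g ≠ 0 := by
    rw [← hval g hg]
    exact (map_ne_zero_iff ι hι).mpr hg0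
  have hxy : ι x * (ι (δ₀ (p 3)) ^ E * aeval y g) = ι (δ₀ (p 3)) ^ E * aeval y f := by
    rw [← hval g hg, ← hval f hf, ← map_mul]
    exact congrArg ι hx
  have hxdiv : ι x = aeval y f / aeval y g := by
    rw [eq_div_iff (right_ne_zero_of_mul hgy)]
    exact mul_left_cancel₀ (left_ne_zero_of_mul hgy) (by rw [← hxy]; ring)
  change ι x ∈ S
  rw [hxdiv]
  exact S.div_mem (hmem f) (hmem g)

/-- corollary.  Given an implicitization-matrix datum for `φ`
(so `det M = c·F^δ` with `c ∈ K` nonzero and `δ ≥ 1`), if `φ` is not proper then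
`δ ≥ 2`; in particular `F²` divides `det M`. -/
theorem two_le_delta_of_not_proper
    (K : Type*) [Field K] [CharZero K]
    (p : Fin 4 → MvPolynomial (Fin 3) K)
    (N : ℕ) (hN : 1 ≤ N) (hphom : ∀ i, (p i).IsHomogeneous N) (hp4 : p 3 ≠ 0)
    (F : MvPolynomial (Fin 4) K)
    (hFhom : ∃ D : ℕ, F.IsHomogeneous D) (hFirr : Irreducible F)
    (hFimp : ∀ G : MvPolynomial (Fin 4) K, aeval p G = 0 ↔ F ∣ G)
    (n : ℕ) (hn : 2 ≤ n) (m : ℕ) (hm : 1 ≤ m)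
    (α : Fin (n + 1) → (Fin 3 →₀ ℕ)) (hαinj : Function.Injective α)
    (hαdeg : ∀ i, (α i).sum (fun _ e => e) = m)
    (b : Fin 3 → Fin (n + 1))
    (hb1 : (X 0 : MvPolynomial (Fin 3) K) * monomial (α (b 2)) 1 =
      (X 2 : MvPolynomial (Fin 3) K) * monomial (α (b 0)) 1)
    (hb2 : (X 1 : MvPolynomial (Fin 3) K) * monomial (α (b 2)) 1 =
      (X 2 : MvPolynomial (Fin 3) K) * monomial (α (b 1)) 1)
    (M : Matrix (Fin (n + 1)) (Fin (n + 1)) (MvPolynomial (Fin 4) K))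
    (hcol0 : ∃ e : ℕ, 1 ≤ e ∧ ∀ i, (M i 0).IsHomogeneous e)
    (hcolhom : ∀ j : Fin n, ∃ dj : ℕ, 1 ≤ dj ∧ ∀ i, (M i j.succ).IsHomogeneous dj)
    (hcolmoving : ∀ j : Fin n,
      ∑ i : Fin (n + 1), (monomial (α i) (1 : K)) * (aeval p) (M i j.succ) = 0)
    (c : K) (hc : c ≠ 0) (δ : ℕ) (hδ : 1 ≤ δ)
    (hMdet : M.det = C c * F ^ δ)
    (hnotproper : ¬ IsProperParam p) :
    2 ≤ δ ∧ F ^ 2 ∣ M.det := by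
  suffices h2 : 2 ≤ δ from ⟨h2, hMdet ▸ Dvd.dvd.mul_left (pow_dvd_pow F h2) _⟩
  by_contra hlt
  obtain rfl : δ = 1 := by omega
  refine hnotproper ?_
  let w : Fin (n + 1) → MvPolynomial (Fin 4) K := fun i => (M.updateCol 0 (Pi.single i 1)).det
  obtain ⟨k, hk⟩ : ∃ k, aeval p (w k) ≠ 0 := by
    by_contra! hall
    choose B hB using fun i => (hFimp (w i)).mp (hall i)
    have hdet : F * ∑ i, M i 0 * B i = F * C c := by
      rw [mul_comm F (C c), ← pow_one F, ← hMdet, pow_one,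
        det_eq_sum_mul_det_updateCol_single M 0, Finset.mul_sum]
      refine Finset.sum_congr rfl fun i _ => ?_
      rw [show (M.updateCol 0 (Pi.single i 1)).det = F * B i from hB i]
      ring
    have hcc := congrArg constantCoeff (mul_left_cancel₀ hFirr.ne_zero hdet)
    obtain ⟨e, he, hMe⟩ := hcol0
    have hM0 : ∀ i, constantCoeff (M i 0) = 0 := fun i =>
      (hMe i).coeff_eq_zero (by simpa using (by omega : (0 : ℕ) ≠ e))
    simp only [map_sum, map_mul, hM0, zero_mul, Finset.sum_const_zero, constantCoeff_C] at hcc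
    exact hc hcc.symm
  choose d _ hd using hcolhom
  have hw : ∀ i, (w i).IsHomogeneous (∑ j, (Fin.cons 0 d : Fin (n + 1) → ℕ) j) := by
    intro i
    refine det_isHomogeneous_of_columns fun r j => ?_
    refine Fin.cases ?_ (fun j => ?_) j
    · rw [Matrix.updateCol_self, Fin.cons_zero, Pi.single_apply]
      split_ifs
      · exact isHomogeneous_one _ _
      · exact isHomogeneous_zero _ _ _
    · rw [Matrix.updateCol_ne (Fin.succ_ne_zero j), Fin.cons_succ]
      exact hd j r
  let v : Fin (n + 1) → MvPolynomial (Fin 3) K := fun i => monomial (α i) 1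
  have hv : ∀ i, v i ≠ 0 := fun i => by simp [v]
  have hwk : ∀ i, v i * aeval p (w k) = v k * aeval p (w i) := by
    have hmap : ∀ i, aeval p (w i) = (((aeval p).mapMatrix M).updateCol 0 (Pi.single i 1)).det := by
      intro i
      rw [AlgHom.map_det]
      congr 1
      ext r j
      simp only [AlgHom.mapMatrix_apply, Matrix.map_apply, Matrix.updateCol_apply, Pi.single_apply]
      split_ifs <;> simp
    intro i
    rw [hmap, hmap]
    refine mul_det_updateCol_single_eq _ 0 v (fun l hl => ?_) i k
    obtain ⟨j, rfl⟩ := Fin.exists_succ_eq.mpr hl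
    exact hcolmoving j
  have hw0 : ∀ i, aeval p (w i) ≠ 0 := fun i =>
    right_ne_zero_of_mul (hwk i ▸ mul_ne_zero (hv i) hk)
  have hratio : ∀ i j, v i * aeval p (w j) = v j * aeval p (w i) := by
    intro i j
    refine mul_left_cancel₀ hk ?_
    linear_combination aeval p (w j) * hwk i - aeval p (w i) * hwk j
  have hcoord : ∀ (a : Fin 3) (i j : Fin (n + 1)), X a * v j = X 2 * v i →
      X a * aeval p (w j) = X 2 * aeval p (w i) := by
    intro a i j h
    refine mul_left_cancel₀ (hv j) ?_
    linear_combination aeval p (w j) * h + X 2 * hratio i j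
  have hwt : ∀ i, aeval ![(X 0 : MvPolynomial (Fin 2) K), X 1, 1] (aeval p (w i)) ≠ 0 := fun i =>
    dehomogenize_ne_zero ((hw i).aeval p hphom) (hw0 i)
  have h3 := dehomogenize_ne_zero (hphom 3) hp4
  refine eq_top_of_X_mem fun a => ?_
  fin_cases a
  · refine mem_adjoin_phiCoord (hw (b 0)) (hw (b 2)) h3 (hwt (b 2)) ?_
    simpa using congrArg (aeval ![(X 0 : MvPolynomial (Fin 2) K), X 1, 1])
      (hcoord 0 (b 0) (b 2) hb1)
  · refine mem_adjoin_phiCoord (hw (b 1)) (hw (b 2)) h3 (hwt (b 2)) ?_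
    simpa using congrArg (aeval ![(X 0 : MvPolynomial (Fin 2) K), X 1, 1])
      (hcoord 1 (b 1) (b 2) hb2)
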